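/- With the same setup, the natural map M/M' → ((lim_n M'/f^nM')[1/f]) / (lim_n M'/f^nM') is an isomorphism of A-modules. -/

import Mathlib

open Submodule in
theorem mem_span_singleton_pow_smul_top {R N : Type*} [CommRing R] [AddCommGroup N] [Module R N]
    {r : R} {n : ℕ} {x : N} :
    x ∈ (Ideal.span {r} ^ n • ⊤ : Submodule R N) ↔ ∃ y, r ^ n • y = x := by
  simp [Ideal.span_singleton_pow, ideal_span_singleton_smul, mem_smul_pointwise_iff_exists]

namespace AdicCompletion

variable {R N : Type*} [CommRing R] [AddCommGroup N] [Module R N]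

/-- Every element of the `r`-adic completion is, modulo `r ^ n`, the image of an element of the
module. -/
theorem exists_eq_of_add_pow_smul (r : R) (n : ℕ) (x : AdicCompletion (Ideal.span {r}) N) :
    ∃ (m : N) (y : AdicCompletion (Ideal.span {r}) N),
      x = of (Ideal.span {r}) N m + r ^ n • y := by
  obtain ⟨m, hm⟩ := Submodule.mkQ_surjective _ (eval (Ideal.span {r}) N n x)
  have hx : x - of (Ideal.span {r}) N m ∈ (eval (Ideal.span {r}) N n).ker := by
    rw [LinearMap.mem_ker, map_sub, eval_of, hm, sub_self]
  rw [← pow_smul_top_eq_ker_eval (Submodule.fg_span_singleton r),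
    mem_span_singleton_pow_smul_top] at hx
  obtain ⟨y, hy⟩ := hx
  exact ⟨m, y, by rw [hy, add_sub_cancel]⟩

/-- An element of the module divisible by `r ^ n` in the `r`-adic completion is divisible by
`r ^ n`. -/
theorem exists_pow_smul_eq_of_of_eq {r : R} {n : ℕ} {m : N}
    {y : AdicCompletion (Ideal.span {r}) N} (h : of (Ideal.span {r}) N m = r ^ n • y) :
    ∃ m', r ^ n • m' = m := by
  rw [← mem_span_singleton_pow_smul_top, ← Submodule.ker_mkQ (Ideal.span {r} ^ n • ⊤),
    LinearMap.mem_ker, ← eval_of, h, ← LinearMap.mem_ker]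
  exact pow_smul_top_le_ker_eval _ n (mem_span_singleton_pow_smul_top.2 ⟨y, rfl⟩)

end AdicCompletion

/-- With `A` Noetherian, `f` a nonzerodivisor, `M'` a finitely generated `A`-module on
which `f` acts injectively, `M = M'[1/f]` and `M̂' = lim_n M'/f^n M'`, the natural map
`M/M' → (M̂'[1/f])/M̂'` is an isomorphism (bijective). -/
theorem quotient_map_to_localized_completion_bijective (A : Type*) [CommRing A]
    [IsNoetherianRing A] (f : A) (hf : f ∈ nonZeroDivisors A)
    (M' : Type*) [AddCommGroup M'] [Module A M'] [Module.Finite A M']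
    (hM' : ∀ m : M', f • m = 0 → m = 0) :
    Function.Bijective
      (Submodule.mapQ
        (LinearMap.range (LocalizedModule.mkLinearMap (Submonoid.powers f) M'))
        (LinearMap.range (LocalizedModule.mkLinearMap (Submonoid.powers f)
          (AdicCompletion (Ideal.span {f}) M')))
        (IsLocalizedModule.map (Submonoid.powers f)
          (LocalizedModule.mkLinearMap (Submonoid.powers f) M')
          (LocalizedModule.mkLinearMap (Submonoid.powers f)
            (AdicCompletion (Ideal.span {f}) M'))
          (AdicCompletion.of (Ideal.span {f}) M'))
        (by
          rintro x ⟨m, rfl⟩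
          simp only [Submodule.mem_comap]
          rw [IsLocalizedModule.map_apply]
          exact ⟨_, rfl⟩)) := by
  have hinj (k : ℕ) : Function.Injective fun m : M' ↦ f ^ k • m :=
    IsSMulRegular.pow k (isSMulRegular_iff_right_eq_zero_of_smul.2 hM')
  constructor
  · rw [injective_iff_map_eq_zero]
    intro q hq
    obtain ⟨z, rfl⟩ := Submodule.mkQ_surjective _ q
    obtain ⟨⟨m, _, n, rfl⟩, rfl⟩ :=
      IsLocalizedModule.mk'_surjective (Submonoid.powers f)
        (LocalizedModule.mkLinearMap (Submonoid.powers f) M') z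
    simp only [Submodule.mkQ_apply, Function.uncurry_apply_pair, Submodule.mapQ_apply,
      IsLocalizedModule.map_mk', Submodule.Quotient.mk_eq_zero] at hq ⊢
    obtain ⟨y, hy⟩ := hq
    rw [eq_comm, IsLocalizedModule.mk'_eq_iff, Submonoid.smul_def, ← map_smul,
      IsLocalizedModule.eq_iff_exists (Submonoid.powers f)] at hy
    obtain ⟨⟨_, k, rfl⟩, hk⟩ := hy
    simp only [Submonoid.smul_def] at hk
    rw [← map_smul, smul_smul, ← pow_add] at hk
    obtain ⟨m', hm'⟩ := AdicCompletion.exists_pow_smul_eq_of_of_eq hk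
    rw [pow_add, mul_smul] at hm'
    refine ⟨m', ?_⟩
    rw [eq_comm, IsLocalizedModule.mk'_eq_iff, Submonoid.smul_def, ← map_smul, hinj k hm']
  · intro q
    obtain ⟨z, rfl⟩ := Submodule.mkQ_surjective _ q
    obtain ⟨⟨x, _, n, rfl⟩, rfl⟩ :=
      IsLocalizedModule.mk'_surjective (Submonoid.powers f)
        (LocalizedModule.mkLinearMap (Submonoid.powers f)
          (AdicCompletion (Ideal.span {f}) M')) z
    obtain ⟨m, y, rfl⟩ := AdicCompletion.exists_eq_of_add_pow_smul f n x
    refine ⟨Submodule.Quotient.mk (IsLocalizedModule.mk'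
      (LocalizedModule.mkLinearMap (Submonoid.powers f) M') m
      (⟨f ^ n, n, rfl⟩ : Submonoid.powers f)), ?_⟩
    simp only [Submodule.mkQ_apply, Function.uncurry_apply_pair, Submodule.mapQ_apply,
      IsLocalizedModule.map_mk']
    rw [eq_comm, Submodule.Quotient.eq, IsLocalizedModule.mk'_add, add_sub_cancel_left]
    refine ⟨y, ?_⟩
    rw [eq_comm, IsLocalizedModule.mk'_eq_iff, Submonoid.smul_def, ← map_smul]
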